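/- Let F ∈ 𝒜 and 0 < δ ≤ 1. Then 𝓗(f_δ)(θ) ≤ 0 for every θ with −1/2 ≤ θ ≤ −δ/2, and 𝓗(F)(x) ≤ 0 for every x ≤ −1/2. -/

import Mathlib

open MeasureTheory

/-- `e t = e^{2πit}`. -/
noncomputable def e (t : ℝ) : ℂ := Complex.exp (2 * Real.pi * Complex.I * t)

/-- Fourier transform `F̂(t) = ∫ F(x) e^{-2πitx} dx`. -/
noncomputable def FT (F : ℝ → ℝ) (t : ℝ) : ℂ :=
  ∫ x : ℝ, (F x : ℂ) * Complex.exp (-(2 * Real.pi * Complex.I) * t * x)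

/-- Hilbert transform on `ℝ` via the multiplier `-i sgn(t)` and Fourier inversion. -/
noncomputable def HilbR (F : ℝ → ℝ) (x : ℝ) : ℂ :=
  ∫ t : ℝ, -Complex.I * (Real.sign t : ℂ) * FT F t * Complex.exp (2 * Real.pi * Complex.I * t * x)

/-- Hilbert transform on `ℝ/ℤ` of the periodization of `F_δ`, via the multiplier `-i sgn(k)`. -/
noncomputable def HilbPer (F : ℝ → ℝ) (δ : ℝ) (θ : ℝ) : ℂ :=
  ∑' k : ℤ, -Complex.I * (Int.sign k : ℂ) * FT F (δ * k) *
    Complex.exp (2 * Real.pi * Complex.I * k * θ)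

/-- The class `𝒜`: even, continuous, nonnegative, supported in `[-1/2,1/2]`, with `F̂ ∈ L¹`. -/
def memA (F : ℝ → ℝ) : Prop :=
  Continuous F ∧ (∀ x, F (-x) = F x) ∧ (∀ x, 0 ≤ F x) ∧
    (∀ x : ℝ, x ∉ Set.Icc (-(1/2) : ℝ) (1/2) → F x = 0) ∧
    MeasureTheory.Integrable (FT F)

/-- `‖𝓗(F)‖_{L^∞(ℝ)}` (sup norm of a bounded continuous function). -/
noncomputable def supHR (F : ℝ → ℝ) : ℝ := ⨆ x : ℝ, ‖HilbR F x‖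

/-- `‖𝓗(f_δ)‖_{L^∞(ℝ/ℤ)}` (sup norm of a bounded continuous function). -/
noncomputable def supHPer (F : ℝ → ℝ) (δ : ℝ) : ℝ := ⨆ θ : ℝ, ‖HilbPer F δ θ‖

/-- `𝒞(F) = max{‖𝓗(F)‖_{L∞(ℝ)}, ‖𝓗(f_F)‖_{L∞(ℝ/ℤ)}}`. -/
noncomputable def CF (F : ℝ → ℝ) : ℝ := max (supHR F) (supHPer F 1)

open MeasureTheory Filter Topology ComplexConjugate

lemma memA_int {F : ℝ → ℝ} (hF : memA F) : Integrable F := by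
  obtain ⟨hc, -, -, hs, -⟩ := hF
  exact hc.integrable_of_hasCompactSupport (HasCompactSupport.intro isCompact_Icc (fun x hx => hs x hx))

lemma conj_two' : (starRingEnd ℂ) (2:ℂ) = 2 := map_ofNat _ 2

lemma norm_expI (u : ℝ) : ‖Complex.exp (2 * Real.pi * Complex.I * u)‖ = 1 := by
  rw [Complex.norm_exp]; simp

lemma FT_neg (F : ℝ → ℝ) (t : ℝ) : FT F (-t) = conj (FT F t) := by
  unfold FT
  rw [← integral_conj]
  congr 1; ext x
  rw [map_mul, ← Complex.exp_conj]
  simp [conj_two']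

lemma FT_even {F : ℝ → ℝ} (hF : memA F) (t : ℝ) : FT F (-t) = FT F t := by
  unfold FT
  rw [← integral_neg_eq_self]
  congr 1; ext x
  rw [hF.2.1]; simp

/-- the half-line part -/
lemma HilbR_eq {F : ℝ → ℝ} (hF : memA F) (x : ℝ) :
    HilbR F x = ((2 * (∫ t in Set.Ioi (0:ℝ), FT F t *
      Complex.exp (2 * Real.pi * Complex.I * t * x)).im : ℝ) : ℂ) := by
  have hi : Integrable (fun t : ℝ => FT F t * Complex.exp (2 * Real.pi * Complex.I * t * x)) := by
    refine hF.2.2.2.2.mul_bdd (c := 1) (by fun_prop) (Eventually.of_forall fun t => ?_)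
    have := norm_expI (t * x)
    push_cast at this
    rw [← mul_assoc] at this
    exact this.le
  set f := fun t : ℝ => FT F t * Complex.exp (2 * Real.pi * Complex.I * t * x) with hf
  have hconj : ∀ t, f (-t) = conj (f t) := by
    intro t
    simp only [hf]
    rw [FT_neg, map_mul, ← Complex.exp_conj]
    simp [conj_two']
  set g := fun t : ℝ => -Complex.I * (Real.sign t : ℂ) * FT F t *
    Complex.exp (2 * Real.pi * Complex.I * t * x) with hg
  have hpos : ∀ t ∈ Set.Ioi (0:ℝ), g t = -Complex.I * f t := by
    intro t ht
    simp only [hg, hf]; rw [Real.sign_of_pos ht]; push_cast; ring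
  have hneg : ∀ t ∈ Set.Ioi (0:ℝ), g (-t) = Complex.I * conj (f t) := by
    intro t ht
    rw [← hconj]
    simp only [hg, hf]; rw [Real.sign_of_neg (by simpa using ht)]; push_cast; ring
  have h1 : IntegrableOn g (Set.Ioi 0) :=
    IntegrableOn.congr_fun (hi.const_mul (-Complex.I)).integrableOn
      (fun t ht => (hpos t ht).symm) measurableSet_Ioi
  have h2' : IntegrableOn g (Set.Iio 0) := by
    refine IntegrableOn.congr_fun (hi.const_mul (Complex.I)).integrableOn
      (fun t ht => ?_) measurableSet_Iio
    simp only [hg]; rw [Real.sign_of_neg ht]; push_cast; ring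
  have h2 : IntegrableOn g (Set.Iic 0) := integrableOn_Iic_iff_integrableOn_Iio (by finiteness) |>.2 h2'
  have : HilbR F x = ∫ t, g t := rfl
  rw [this, ← intervalIntegral.integral_Iic_add_Ioi h2 h1]
  have e1 : ∫ t in Set.Iic (0:ℝ), g t = ∫ t in Set.Ioi (0:ℝ), g (-t) := by
    rw [integral_comp_neg_Ioi]; simp
  rw [e1, setIntegral_congr_fun measurableSet_Ioi hpos, setIntegral_congr_fun measurableSet_Ioi hneg,
    integral_const_mul, integral_const_mul, integral_conj]
  apply Complex.ext <;> simp
  ring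

lemma real_reg {F : ℝ → ℝ} (hF : memA F) (x : ℝ) (hx : x ≤ -(1/2)) (ε : ℝ) (hε : 0 < ε) :
    (∫ t in Set.Ioi (0:ℝ), (Real.exp (-ε * t) : ℂ) * (FT F t *
      Complex.exp (2 * Real.pi * Complex.I * t * x))).im ≤ 0 := by
  have hFi := memA_int hF
  have hexp : IntegrableOn (fun t : ℝ => Real.exp (-ε * t)) (Set.Ioi 0) :=
    integrableOn_exp_mul_Ioi (by linarith) 0
  have hprod : Integrable (fun p : ℝ × ℝ => ((Real.exp (-ε * p.1) : ℂ) * (F p.2 : ℂ)) *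
      Complex.exp (2 * Real.pi * Complex.I * ((p.1 * (x - p.2) : ℝ) : ℂ)))
      ((volume.restrict (Set.Ioi (0:ℝ))).prod volume) := by
    refine Integrable.mul_bdd (c := 1) (Integrable.mul_prod hexp.ofReal hFi.ofReal) ?_ ?_
    · exact (by fun_prop : Continuous _).aestronglyMeasurable
    · exact Eventually.of_forall fun p => (norm_expI _).le
  have e1 : ∀ t : ℝ, (Real.exp (-ε * t) : ℂ) * (FT F t *
      Complex.exp (2 * Real.pi * Complex.I * t * x)) = ∫ y : ℝ, ((Real.exp (-ε * t) : ℂ) * (F y : ℂ)) *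
      Complex.exp (2 * Real.pi * Complex.I * ((t * (x - y) : ℝ) : ℂ)) := by
    intro t
    unfold FT
    rw [← integral_mul_const, ← integral_const_mul]
    congr 1; ext y
    rw [mul_assoc (F y : ℂ), ← Complex.exp_add, ← mul_assoc]
    congr 2
    push_cast; ring
  simp_rw [e1]
  rw [integral_integral_swap hprod]
  have e2 : ∀ y : ℝ, (∫ t in Set.Ioi (0:ℝ), ((Real.exp (-ε * t) : ℂ) * (F y : ℂ)) *
      Complex.exp (2 * Real.pi * Complex.I * ((t * (x - y) : ℝ) : ℂ)))
      = F y * (-1 / (-ε + 2 * Real.pi * (x - y) * Complex.I)) := by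
    intro y
    have := integral_exp_mul_complex_Ioi (a := -ε + 2 * Real.pi * (x - y) * Complex.I) (by simp [hε]) 0
    simp only [Complex.ofReal_zero, mul_zero, Complex.exp_zero] at this
    rw [← this, ← integral_const_mul]
    congr 1; ext t
    rw [mul_comm (Complex.ofReal _) (F y : ℂ), mul_assoc, Complex.ofReal_exp, ← Complex.exp_add]
    congr 2
    push_cast; ring
  simp_rw [e2]
  have hint := hprod.integral_prod_right
  simp only [e2] at hint
  have := integral_im hint
  simp only [RCLike.im_to_complex] at this
  rw [← this]
  refine integral_nonpos fun y => ?_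
  simp only [Pi.zero_apply, Complex.re_ofReal_mul, Complex.im_ofReal_mul]
  by_cases hy : y ∈ Set.Icc (-(1/2) : ℝ) (1/2)
  · refine mul_nonpos_of_nonneg_of_nonpos (hF.2.2.1 y) ?_
    rw [Complex.div_im]
    simp
    refine div_nonneg ?_ (Complex.normSq_nonneg _)
    have := Real.pi_pos
    have : x - y ≤ 0 := by linarith [hy.1]
    nlinarith
  · rw [hF.2.2.2.1 y hy]; simp

lemma HilbR_main {F : ℝ → ℝ} (hF : memA F) (x : ℝ) (hx : x ≤ -(1/2)) :
    (HilbR F x).re ≤ 0 ∧ (HilbR F x).im = 0 := by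
  rw [HilbR_eq hF]
  refine ⟨?_, Complex.ofReal_im _⟩
  rw [Complex.ofReal_re]
  have hi : Integrable (fun t : ℝ => FT F t * Complex.exp (2 * Real.pi * Complex.I * t * x)) := by
    refine hF.2.2.2.2.mul_bdd (c := 1) (by fun_prop) (Eventually.of_forall fun t => ?_)
    have := norm_expI (t * x)
    push_cast at this
    rw [← mul_assoc] at this
    exact this.le
  have ht : Tendsto (fun ε : ℝ => ∫ t in Set.Ioi (0:ℝ), (Real.exp (-ε * t) : ℂ) * (FT F t *
      Complex.exp (2 * Real.pi * Complex.I * t * x))) (𝓝[>] 0)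
      (𝓝 (∫ t in Set.Ioi (0:ℝ), FT F t * Complex.exp (2 * Real.pi * Complex.I * t * x))) := by
    refine tendsto_integral_filter_of_dominated_convergence
      (fun t => ‖FT F t * Complex.exp (2 * Real.pi * Complex.I * t * x)‖) ?_ ?_ hi.norm.integrableOn ?_
    · refine Eventually.of_forall fun ε => ?_
      refine AEStronglyMeasurable.mul ?_ hi.aestronglyMeasurable.restrict
      exact (by fun_prop : Continuous _).aestronglyMeasurable
    · filter_upwards [self_mem_nhdsWithin] with ε hε
      filter_upwards [ae_restrict_mem measurableSet_Ioi] with t ht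
      rw [norm_mul]
      refine mul_le_of_le_one_left (norm_nonneg _) ?_
      rw [Complex.norm_real, Real.norm_eq_abs, Real.abs_exp, Real.exp_le_one_iff]
      have h1 : 0 < ε := hε
      have h2 : 0 < t := ht
      nlinarith
    · refine Eventually.of_forall fun t => ?_
      have : Continuous (fun ε : ℝ => (Real.exp (-ε * t) : ℂ) * (FT F t *
        Complex.exp (2 * Real.pi * Complex.I * t * x))) := by fun_prop
      have h := (this.tendsto 0).mono_left (nhdsWithin_le_nhds (s := Set.Ioi 0))
      simpa using h
  have him := (Complex.continuous_im.tendsto _).comp ht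
  have : _ ≤ (0:ℝ) := le_of_tendsto him (by
    filter_upwards [self_mem_nhdsWithin] with ε hε
    exact real_reg hF x hx ε hε)
  linarith

/-- point on the circle -/
noncomputable def ww (θ δ y : ℝ) : ℂ := Complex.exp (2 * Real.pi * Complex.I * ((θ - δ * y : ℝ) : ℂ))

lemma ww_cont (θ δ : ℝ) : Continuous (ww θ δ) := by unfold ww; fun_prop

lemma ww_norm (θ δ y : ℝ) : ‖ww θ δ y‖ = 1 := norm_expI _

lemma ww_eq (θ δ y : ℝ) : ww θ δ y = Complex.exp (((2 * Real.pi * (θ - δ * y) : ℝ) : ℂ) * Complex.I) := by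
  unfold ww; congr 1; push_cast; ring

lemma ww_re (θ δ y : ℝ) : (ww θ δ y).re = Real.cos (2 * Real.pi * (θ - δ * y)) := by
  rw [ww_eq, Complex.exp_ofReal_mul_I_re]
lemma ww_im (θ δ y : ℝ) : (ww θ δ y).im = Real.sin (2 * Real.pi * (θ - δ * y)) := by
  rw [ww_eq, Complex.exp_ofReal_mul_I_im]

lemma cos_lt {θ δ y : ℝ} (hδ0 : 0 < δ) (hδ1 : δ < 1) (h1 : -(1/2) ≤ θ) (h2 : θ < -(δ/2))
    (hy : y ∈ Set.Icc (-(1/2) : ℝ) (1/2)) : Real.cos (2 * Real.pi * (θ - δ * y)) < 1 := by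
  refine lt_of_le_of_ne (Real.cos_le_one _) fun h => ?_
  have hp := Real.pi_pos
  have ha : θ - δ * y < 0 := by nlinarith [hy.1]
  have hb : -1 < θ - δ * y := by nlinarith [hy.2]
  rw [Real.cos_eq_one_iff_of_lt_of_lt (by nlinarith) (by nlinarith)] at h
  nlinarith

lemma ww_ne {θ δ y : ℝ} (hδ0 : 0 < δ) (hδ1 : δ < 1) (h1 : -(1/2) ≤ θ) (h2 : θ < -(δ/2))
    (hy : y ∈ Set.Icc (-(1/2) : ℝ) (1/2)) : 1 - ww θ δ y ≠ 0 := by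
  intro h
  have := congrArg Complex.re h
  rw [Complex.sub_re, ww_re] at this
  have h3 := cos_lt hδ0 hδ1 h1 h2 hy
  simp at this
  linarith

lemma kernel_im (θ δ y : ℝ) : (ww θ δ y / (1 - ww θ δ y)).im =
    Real.sin (2 * Real.pi * (θ - δ * y)) / (2 - 2 * Real.cos (2 * Real.pi * (θ - δ * y))) := by
  have hn : Complex.normSq (1 - ww θ δ y) = 2 - 2 * Real.cos (2 * Real.pi * (θ - δ * y)) := by
    rw [Complex.normSq_apply]
    simp only [Complex.sub_re, Complex.sub_im, ww_re, ww_im, Complex.one_re, Complex.one_im]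
    nlinarith [Real.sin_sq_add_cos_sq (2 * Real.pi * (θ - δ * y))]
  rw [Complex.div_im, hn]
  simp only [Complex.sub_re, Complex.sub_im, ww_re, ww_im, Complex.one_re, Complex.one_im]
  ring

lemma kernel_sign {θ δ y : ℝ} (hδ0 : 0 < δ) (hδ1 : δ < 1) (h1 : -(1/2) ≤ θ) (h2 : θ < -(δ/2))
    (hy : y ∈ Set.Icc (-(1/2) : ℝ) (1/2)) :
    (ww θ δ y / (1 - ww θ δ y)).im + (ww θ δ (-y) / (1 - ww θ δ (-y))).im ≤ 0 := by
  have hy' : -y ∈ Set.Icc (-(1/2) : ℝ) (1/2) := ⟨by linarith [hy.2], by linarith [hy.1]⟩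
  have c1 := cos_lt hδ0 hδ1 h1 h2 hy
  have c2 := cos_lt hδ0 hδ1 h1 h2 hy'
  rw [kernel_im, kernel_im]
  have ea : 2 * Real.pi * (θ - δ * y) = 2 * Real.pi * θ - 2 * Real.pi * (δ * y) := by ring
  have eb : 2 * Real.pi * (θ - δ * -y) = 2 * Real.pi * θ + 2 * Real.pi * (δ * y) := by ring
  rw [ea] at c1 ⊢
  rw [eb] at c2 ⊢
  have hp := Real.pi_pos
  have hs : Real.sin (2 * Real.pi * θ) ≤ 0 :=
    Real.sin_nonpos_of_nonpos_of_neg_pi_le (by nlinarith) (by nlinarith)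
  have hc : Real.cos (2 * Real.pi * θ) ≤ Real.cos (2 * Real.pi * (δ * y)) := by
    rw [← Real.cos_abs (2 * Real.pi * θ), ← Real.cos_abs (2 * Real.pi * (δ * y))]
    apply Real.cos_le_cos_of_nonneg_of_le_pi (abs_nonneg _)
    · rw [abs_le]; constructor <;> nlinarith
    · rw [abs_mul, abs_mul (2 * Real.pi)]
      refine mul_le_mul_of_nonneg_left ?_ (abs_nonneg _)
      rw [abs_of_neg (a := θ) (by linarith), abs_le]
      constructor <;> nlinarith [hy.1, hy.2]
  set a := 2 * Real.pi * θ
  set b := 2 * Real.pi * (δ * y)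
  rw [div_add_div _ _ (by linarith) (by linarith)]
  refine div_nonpos_of_nonpos_of_nonneg ?_ (by nlinarith)
  have : Real.sin (a - b) * (2 - 2 * Real.cos (a + b)) + (2 - 2 * Real.cos (a - b)) * Real.sin (a + b)
      = 4 * Real.sin a * (Real.cos b - Real.cos a) := by
    have hb2 : Real.cos b ^ 2 = 1 - Real.sin b ^ 2 := by nlinarith [Real.sin_sq_add_cos_sq b]
    rw [Real.sin_sub, Real.sin_add, Real.cos_add, Real.cos_sub]
    ring_nf
    rw [hb2]; ring
  rw [this]
  nlinarith

lemma kernel_cont {F : ℝ → ℝ} (hF : memA F) {G : Type*} [NormedRing G] (u : ℝ → G)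
    (c : ℝ → G) (hc : ∀ y, F y = 0 → c y = 0)
    (hu : ContinuousOn (fun y => c y * u y) (Set.Icc (-(1/2) : ℝ) (1/2))) :
    Integrable (fun y => c y * u y) := by
  rw [← integrableOn_iff_integrable_of_support_subset (s := Set.Icc (-(1/2) : ℝ) (1/2))]
  · exact hu.integrableOn_Icc
  · intro y hy
    by_contra h
    exact hy (by simp [hc y (hF.2.2.2.1 y h)])

lemma limit_sign {F : ℝ → ℝ} (hF : memA F) {θ δ : ℝ} (hδ0 : 0 < δ) (hδ1 : δ < 1)
    (h1 : -(1/2) ≤ θ) (h2 : θ < -(δ/2)) :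
    (∫ y, (F y : ℂ) * (ww θ δ y / (1 - ww θ δ y))).im ≤ 0 := by
  have hint : Integrable (fun y => (F y : ℂ) * (ww θ δ y / (1 - ww θ δ y))) := by
    refine kernel_cont hF _ _ (fun y h => by simp [h]) ?_
    refine ContinuousOn.mul (Complex.continuous_ofReal.comp hF.1).continuousOn ?_
    exact ContinuousOn.div (ww_cont _ _).continuousOn (by have := ww_cont θ δ; fun_prop)
      (fun y hy => ww_ne hδ0 hδ1 h1 h2 hy)
  have := integral_im hint
  simp only [RCLike.im_to_complex] at this
  rw [← this]
  have hre : Integrable (fun y => ((F y : ℂ) * (ww θ δ y / (1 - ww θ δ y))).im) := hint.im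
  set k := fun y => ((F y : ℂ) * (ww θ δ y / (1 - ww θ δ y))).im with hk
  have e1 : ∫ y, k (-y) = ∫ y, k y := integral_neg_eq_self k volume
  have e2 : ∫ y, (k y + k (-y)) ≤ 0 := by
    refine integral_nonpos fun y => ?_
    simp only [hk, Pi.zero_apply, Complex.im_ofReal_mul, hF.2.1]
    rw [← mul_add]
    by_cases hy : y ∈ Set.Icc (-(1/2) : ℝ) (1/2)
    · exact mul_nonpos_of_nonneg_of_nonpos (hF.2.2.1 y) (kernel_sign hδ0 hδ1 h1 h2 hy)
    · rw [hF.2.2.2.1 y hy]; simp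
  rw [integral_add hre hre.comp_neg, e1] at e2
  linarith

lemma per_reg {F : ℝ → ℝ} (hF : memA F) (θ δ r : ℝ) (hr0 : 0 < r) (hr1 : r < 1) :
    ∑' n : ℕ, (r : ℂ) ^ n * (FT F (δ * (n + 1)) * Complex.exp (2 * Real.pi * Complex.I * (n + 1) * θ))
      = ∫ y, (F y : ℂ) * (ww θ δ y / (1 - r * ww θ δ y)) := by
  have hFi := memA_int hF
  have e1 : ∀ n : ℕ, (r : ℂ) ^ n * (FT F (δ * (n + 1)) * Complex.exp (2 * Real.pi * Complex.I * (n + 1) * θ))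
     = ∫ y, (F y : ℂ) * (ww θ δ y * (r * ww θ δ y) ^ n) := by
    intro n
    unfold FT
    rw [← integral_mul_const, ← integral_const_mul]
    congr 1; ext y
    rw [mul_pow, mul_assoc, ← Complex.exp_add]
    have : ww θ δ y * (r ^ n * ww θ δ y ^ n) = r ^ n * ww θ δ y ^ (n + 1) := by ring
    rw [this]
    unfold ww
    rw [← Complex.exp_nat_mul]
    rw [mul_left_comm]
    congr 3
    push_cast; ring
  simp_rw [e1]
  have hn : ∀ (n : ℕ) y, ‖(F y : ℂ) * (ww θ δ y * (r * ww θ δ y) ^ n)‖ = r ^ n * F y := by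
    intro n y
    simp [ww_norm, abs_of_nonneg (hF.2.2.1 y), abs_of_pos hr0, mul_comm]
  have hI : ∀ n : ℕ, Integrable (fun y => (F y : ℂ) * (ww θ δ y * (r * ww θ δ y) ^ n)) := by
    intro n
    refine kernel_cont hF _ _ (fun y h => by simp [h]) ?_
    have := ww_cont θ δ
    have := hF.1
    fun_prop
  have := hasSum_integral_of_summable_integral_norm hI (by
    simp_rw [hn, integral_const_mul]
    exact (summable_geometric_of_lt_one hr0.le hr1).mul_right _)
  rw [this.tsum_eq]
  congr 1; ext y
  rw [tsum_mul_left, tsum_mul_left, tsum_geometric_of_norm_lt_one]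
  · rw [div_eq_mul_inv]
  · simp [ww_norm, abs_of_pos hr0, hr1]

lemma per_lim {F : ℝ → ℝ} (hF : memA F) {θ δ : ℝ} (hδ0 : 0 < δ) (hδ1 : δ < 1)
    (h1 : -(1/2) ≤ θ) (h2 : θ < -(δ/2))
    (hs : Summable fun n : ℕ => ‖FT F (δ * (n + 1))‖) :
    (∑' n : ℕ, FT F (δ * (n + 1)) * Complex.exp (2 * Real.pi * Complex.I * (n + 1) * θ)).im ≤ 0 := by
  have hmem : ∀ᶠ r : ℝ in 𝓝[<] 1, r ∈ Set.Ioo (0:ℝ) 1 := Ioo_mem_nhdsLT one_pos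
  have hnorm : ∀ n : ℕ, ‖Complex.exp (2 * Real.pi * Complex.I * (n + 1) * θ)‖ = 1 := by
    intro n
    have := norm_expI ((n + 1) * θ)
    push_cast at this
    rwa [← mul_assoc] at this
  have t1 : Tendsto (fun r : ℝ => ∑' n : ℕ, (r : ℂ) ^ n * (FT F (δ * (n + 1)) *
      Complex.exp (2 * Real.pi * Complex.I * (n + 1) * θ))) (𝓝[<] 1)
      (𝓝 (∑' n : ℕ, FT F (δ * (n + 1)) * Complex.exp (2 * Real.pi * Complex.I * (n + 1) * θ))) := by
    refine tendsto_tsum_of_dominated_convergence hs ?_ ?_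
    · intro n
      have : Continuous (fun r : ℝ => (r : ℂ) ^ n * (FT F (δ * (n + 1)) *
        Complex.exp (2 * Real.pi * Complex.I * (n + 1) * θ))) := by fun_prop
      have h := (this.tendsto 1).mono_left (nhdsWithin_le_nhds (s := Set.Iio 1))
      simpa using h
    · filter_upwards [hmem] with r hr n
      rw [norm_mul, norm_mul, hnorm, mul_one, norm_pow, Complex.norm_real, Real.norm_eq_abs,
        abs_of_pos hr.1]
      exact mul_le_of_le_one_left (norm_nonneg _) (pow_le_one₀ hr.1.le hr.2.le)
  have t2 : Tendsto (fun r : ℝ => ∫ y, (F y : ℂ) * (ww θ δ y / (1 - r * ww θ δ y))) (𝓝[<] 1)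
      (𝓝 (∫ y, (F y : ℂ) * (ww θ δ y / (1 - ww θ δ y)))) := by
    refine tendsto_integral_filter_of_dominated_convergence
      (fun y => F y * (2 / ‖1 - ww θ δ y‖)) ?_ ?_ ?_ ?_
    · refine Eventually.of_forall fun r => ?_
      have := (ww_cont θ δ).measurable
      have := hF.1.measurable
      exact (by fun_prop : Measurable _).aestronglyMeasurable
    · filter_upwards [hmem] with r hr
      refine Eventually.of_forall fun y => ?_
      rw [norm_mul, norm_div, ww_norm, Complex.norm_real, Real.norm_eq_abs, abs_of_nonneg (hF.2.2.1 y)]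
      by_cases hy : y ∈ Set.Icc (-(1/2) : ℝ) (1/2)
      · refine mul_le_mul_of_nonneg_left ?_ (hF.2.2.1 y)
        have hp : 0 < ‖1 - ww θ δ y‖ := norm_pos_iff.2 (ww_ne hδ0 hδ1 h1 h2 hy)
        have hle : 1 - r ≤ ‖1 - r * ww θ δ y‖ := by
          have := norm_sub_norm_le (1 : ℂ) (r * ww θ δ y)
          simpa [ww_norm, abs_of_pos hr.1] using this
        have hle2 : ‖1 - ww θ δ y‖ ≤ ‖1 - r * ww θ δ y‖ + (1 - r) := by
          have e : 1 - ww θ δ y = (1 - r * ww θ δ y) - ((1 - r : ℝ) : ℂ) * ww θ δ y := by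
            push_cast; ring
          rw [e]
          refine (norm_sub_le _ _).trans ?_
          rw [norm_mul, ww_norm, Complex.norm_real, Real.norm_eq_abs, abs_of_pos (by linarith [hr.2])]
          linarith
        rw [div_le_div_iff₀ (by linarith [hr.2]) hp]
        linarith
      · rw [hF.2.2.2.1 y hy]; simp
    · refine kernel_cont hF _ _ (fun y h => by simp [h]) ?_
      refine ContinuousOn.mul hF.1.continuousOn ?_
      exact ContinuousOn.div continuousOn_const (by have := ww_cont θ δ; fun_prop)
        (fun y hy => norm_ne_zero_iff.2 (ww_ne hδ0 hδ1 h1 h2 hy))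
    · refine Eventually.of_forall fun y => ?_
      by_cases hy : y ∈ Set.Icc (-(1/2) : ℝ) (1/2)
      · have hne := ww_ne hδ0 hδ1 h1 h2 hy
        have : ContinuousAt (fun r : ℝ => (F y : ℂ) * (ww θ δ y / (1 - r * ww θ δ y))) 1 := by
          refine ContinuousAt.mul continuousAt_const (ContinuousAt.div continuousAt_const (by fun_prop) ?_)
          simpa using hne
        have h := this.tendsto.mono_left (nhdsWithin_le_nhds (s := Set.Iio 1))
        simpa using h
      · rw [hF.2.2.2.1 y hy]; simp
  have t3 := t2.congr' (by
    filter_upwards [hmem] with r hr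
    exact (per_reg hF θ δ r hr.1 hr.2).symm)
  rw [tendsto_nhds_unique t1 t3]
  exact limit_sign hF hδ0 hδ1 h1 h2

lemma per_all {F : ℝ → ℝ} (hF : memA F) {θ δ : ℝ} (hδ0 : 0 < δ) (hδ1 : δ ≤ 1)
    (h1 : -(1/2) ≤ θ) (h2 : θ ≤ -(δ/2))
    (hs : Summable fun n : ℕ => ‖FT F (δ * (n + 1))‖) :
    (∑' n : ℕ, FT F (δ * (n + 1)) * Complex.exp (2 * Real.pi * Complex.I * (n + 1) * θ)).im ≤ 0 := by
  have hnorm : ∀ (n : ℕ) (θ : ℝ), ‖Complex.exp (2 * Real.pi * Complex.I * (n + 1) * θ)‖ = 1 := by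
    intro n θ
    have := norm_expI ((n + 1) * θ)
    push_cast at this
    rwa [← mul_assoc] at this
  rcases hδ1.lt_or_eq with hlt | rfl
  · have hcont : Continuous fun θ : ℝ => (∑' n : ℕ, FT F (δ * (n + 1)) *
        Complex.exp (2 * Real.pi * Complex.I * (n + 1) * θ)).im := by
      refine Complex.continuous_im.comp ?_
      refine continuous_tsum (fun n => by fun_prop) hs (fun n x => ?_)
      rw [norm_mul, hnorm, mul_one]
    have hcl : IsClosed {θ : ℝ | (∑' n : ℕ, FT F (δ * (n + 1)) *
        Complex.exp (2 * Real.pi * Complex.I * (n + 1) * θ)).im ≤ 0} :=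
      isClosed_le hcont continuous_const
    have hsub := closure_minimal (s := Set.Ico (-(1/2) : ℝ) (-(δ/2)))
      (fun θ hθ => per_lim hF hδ0 hlt hθ.1 hθ.2 hs) hcl
    rw [closure_Ico (by linarith)] at hsub
    exact hsub ⟨h1, h2⟩
  · have : θ = -(1/2) := by linarith
    subst this
    have hsum : Summable fun n : ℕ => FT F (1 * (n + 1)) *
        Complex.exp (2 * Real.pi * Complex.I * (n + 1) * ((-(1/2) : ℝ) : ℂ)) := by
      refine Summable.of_norm_bounded hs fun n => ?_
      rw [norm_mul, hnorm, mul_one]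
    rw [Complex.im_tsum hsum]
    refine le_of_eq ?_
    convert tsum_zero with n
    have hr : (FT F (1 * (n + 1))).im = 0 := by
      have h := FT_neg F (1 * (n + 1))
      rw [FT_even hF] at h
      exact Complex.conj_eq_iff_im.1 h.symm
    have he : Complex.exp (2 * Real.pi * Complex.I * (n + 1) * ((-(1/2) : ℝ) : ℂ)) =
        (((-1 : ℝ) ^ (n + 1) : ℝ) : ℂ) := by
      have : 2 * Real.pi * Complex.I * (n + 1) * ((-(1/2) : ℝ) : ℂ) =
        ((n + 1 : ℕ) : ℂ) * (-(Real.pi * Complex.I)) := by push_cast; ring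
      rw [this, Complex.exp_nat_mul, Complex.exp_neg, Complex.exp_pi_mul_I]
      push_cast; norm_num
    rw [he, Complex.im_mul_ofReal, hr, zero_mul]

lemma HilbPer_main {F : ℝ → ℝ} (hF : memA F) {θ δ : ℝ} (hδ0 : 0 < δ) (hδ1 : δ ≤ 1)
    (h1 : -(1/2) ≤ θ) (h2 : θ ≤ -(δ/2)) :
    (HilbPer F δ θ).re ≤ 0 ∧ (HilbPer F δ θ).im = 0 := by
  unfold HilbPer
  set f := fun k : ℤ => -Complex.I * (Int.sign k : ℂ) * FT F (δ * k) *
    Complex.exp (2 * Real.pi * Complex.I * k * θ) with hf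
  by_cases hsum : Summable f
  swap
  · rw [tsum_eq_zero_of_not_summable hsum]; simp
  have hnorm : ∀ (n : ℕ), ‖Complex.exp (2 * Real.pi * Complex.I * (n + 1) * θ)‖ = 1 := by
    intro n
    have := norm_expI ((n + 1) * θ)
    push_cast at this
    rwa [← mul_assoc] at this
  have hpos : ∀ n : ℕ, f ((n : ℤ) + 1) = -Complex.I * (FT F (δ * (n + 1)) *
      Complex.exp (2 * Real.pi * Complex.I * (n + 1) * θ)) := by
    intro n
    simp only [hf]
    rw [Int.sign_eq_one_of_pos (by positivity)]
    push_cast; ring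
  have hneg : ∀ n : ℕ, f (-((n : ℤ) + 1)) = conj (f ((n : ℤ) + 1)) := by
    intro n
    rw [hpos]
    simp only [hf]
    rw [Int.sign_eq_neg_one_of_neg (by omega)]
    have : δ * ((-((n : ℤ) + 1) : ℤ) : ℝ) = -(δ * (n + 1)) := by push_cast; ring
    rw [this, FT_neg, map_mul, map_mul, ← Complex.exp_conj]
    simp [conj_two']
    ring_nf
  have hS : Summable fun n : ℕ => f ((n : ℤ) + 1) :=
    hsum.comp_injective (i := fun n : ℕ => (n : ℤ) + 1) (fun a b h => by simpa using h)
  have hs : Summable fun n : ℕ => ‖FT F (δ * (n + 1))‖ := by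
    refine hS.norm.congr fun n => ?_
    rw [hpos, norm_mul, norm_mul, hnorm]; simp
  have hmain := per_all hF hδ0 hδ1 h1 h2 hs
  have hS' := hS.hasSum
  have hC : HasSum (fun n : ℕ => f (-((n : ℤ) + 1))) (conj (∑' n : ℕ, f ((n : ℤ) + 1))) := by
    simp_rw [hneg]
    exact Complex.hasSum_conj'.2 (by simpa using hS')
  have htot := HasSum.of_add_one_of_neg_add_one hS' hC
  have h0 : f 0 = 0 := by simp [hf]
  rw [htot.tsum_eq, h0]
  simp_rw [hpos]
  rw [tsum_mul_left]
  constructor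
  · simp; linarith
  · simp

/-- Sign information: for `F ∈ 𝒜` and `0 < δ ≤ 1`, the (real-valued) periodic Hilbert
transform `𝓗(f_δ)` is `≤ 0` on `[-1/2, -δ/2]`, and `𝓗(F)` is `≤ 0` on `(-∞, -1/2]`. -/
theorem stmt8 (F : ℝ → ℝ) (hF : memA F) (δ : ℝ) (hδ0 : 0 < δ) (hδ1 : δ ≤ 1) :
    (∀ θ : ℝ, -(1/2) ≤ θ → θ ≤ -(δ/2) →
      (HilbPer F δ θ).re ≤ 0 ∧ (HilbPer F δ θ).im = 0) ∧
    (∀ x : ℝ, x ≤ -(1/2) → (HilbR F x).re ≤ 0 ∧ (HilbR F x).im = 0) := by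
  exact ⟨fun θ h1 h2 => HilbPer_main hF hδ0 hδ1 h1 h2, fun x hx => HilbR_main hF x hx⟩
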